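/- For every q ∈ Q there exists a vector y ∈ ℝ^Q such that α^T M(w) y = α^T y for all w ∈ Σ*, y(q) = 1, and y(q') = 0 for all q' ∉ Mer(q); i.e., for every state q the linear system defining maximal pseudo-columns with witness q has a solution. -/

import Mathlib

open Matrix

/-- Indicator (0/1) column vector of a set of states: `ind S q = 1` iff `q ∈ S`. -/
noncomputable def ind {Q : Type*} (S : Set Q) : Q → ℝ := S.indicator 1

namespace UFA

variable {Q σ : Type*}

/-- `y` is a column of the monoid morphism `M`, i.e. `y = M(w)[q]` for some word `w`, state `q`. -/
def IsCol (M : List σ → Matrix Q Q ℝ) (y : Q → ℝ) : Prop :=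
  ∃ w : List σ, ∃ q : Q, y = fun p => M w p q

/-- `x` is a row of `M`, i.e. `xᵀ = [q]ᵀ M(w)` for some word `w` and state `q`. -/
def IsRow (M : List σ → Matrix Q Q ℝ) (x : Q → ℝ) : Prop :=
  ∃ w : List σ, ∃ q : Q, x = fun p => M w q p

/-- A maximal column: a column `y` such that no column `y' ≠ y` satisfies `y' ≥ y`. -/
def IsMaxCol (M : List σ → Matrix Q Q ℝ) (y : Q → ℝ) : Prop :=
  IsCol M y ∧ ∀ y', IsCol M y' → y ≤ y' → y' = y

/-- A maximal row: a row `x` such that no row `x' ≠ x` satisfies `x' ≥ x`. -/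
def IsMaxRow (M : List σ → Matrix Q Q ℝ) (x : Q → ℝ) : Prop :=
  IsRow M x ∧ ∀ x', IsRow M x' → x ≤ x' → x' = x

/-- Unambiguous rank of a zero-one matrix: the least `r` such that `A = C * R` with `C, R`
zero-one matrices having `r` columns resp. `r` rows. -/
noncomputable def rankUnMat (A : Matrix Q Q ℝ) : ℕ :=
  sInf {r : ℕ | ∃ C : Matrix Q (Fin r) ℝ, ∃ R : Matrix (Fin r) Q ℝ,
    (∀ i j, C i j = 0 ∨ C i j = 1) ∧ (∀ i j, R i j = 0 ∨ R i j = 1) ∧ A = C * R}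

/-- Minimum unambiguous rank of the matrix monoid generated by `M`. -/
noncomputable def rankUn (M : List σ → Matrix Q Q ℝ) : ℕ :=
  sInf (Set.range fun w => rankUnMat (M w))

/-- Minimum real rank of the matrix monoid generated by `M`. -/
noncomputable def rankReal [Fintype Q] (M : List σ → Matrix Q Q ℝ) : ℕ :=
  sInf (Set.range fun w => (M w).rank)

/-- `Mer M q`: the set of states that appear together with `q` in some column. -/
def Mer (M : List σ → Matrix Q Q ℝ) (q : Q) : Set Q :=
  {q' | ∃ S : Set Q, q ∈ S ∧ q' ∈ S ∧ IsCol M (ind S)}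

end UFA

namespace UFA

section Columns

variable {Q σ : Type*}

/-- A zero-one column is the indicator of its support. -/
theorem IsCol.eq_ind {M : List σ → Matrix Q Q ℝ} (hUn : ∀ w i j, M w i j = 0 ∨ M w i j = 1)
    {y : Q → ℝ} (hy : IsCol M y) : y = ind {p | y p = 1} := by
  obtain ⟨w, q, rfl⟩ := hy
  funext p
  rcases hUn w p q with h | h <;> simp [ind, Set.indicator, h]

theorem finite_setOf_isCol [Finite Q] {M : List σ → Matrix Q Q ℝ}
    (hUn : ∀ w i j, M w i j = 0 ∨ M w i j = 1) : {y | IsCol M y}.Finite :=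
  (Set.finite_range (ind : Set Q → Q → ℝ)).subset fun _ hy => ⟨_, (hy.eq_ind hUn).symm⟩

variable [Fintype Q]

theorem IsCol.mulVec {M : List σ → Matrix Q Q ℝ} (hMm : ∀ u v, M (u ++ v) = M u * M v)
    {y : Q → ℝ} (hy : IsCol M y) (w : List σ) : IsCol M (M w *ᵥ y) := by
  obtain ⟨u, q, rfl⟩ := hy
  refine ⟨w ++ u, q, ?_⟩
  funext p
  simp [hMm, Matrix.mul_apply, Matrix.mulVec, dotProduct]

/-- The weight of a column of maximal weight is preserved by every letter. -/
theorem IsCol.dotProduct_letter_mulVec_eq [Fintype σ] [Nonempty σ] {M : List σ → Matrix Q Q ℝ}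
    (hMm : ∀ u v, M (u ++ v) = M u * M v) {α : Q → ℝ}
    (hαA : α ᵥ* ((Fintype.card σ : ℝ)⁻¹ • ∑ a : σ, M [a]) = α)
    {y : Q → ℝ} (hy : IsCol M y) (hmax : ∀ z, IsCol M z → α ⬝ᵥ z ≤ α ⬝ᵥ y) (a : σ) :
    α ⬝ᵥ (M [a] *ᵥ y) = α ⬝ᵥ y := by
  have hcard : (Fintype.card σ : ℝ) ≠ 0 := by simp
  have hsum : ∑ a : σ, α ⬝ᵥ (M [a] *ᵥ y) = ∑ _a : σ, α ⬝ᵥ y := by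
    have h : (Fintype.card σ : ℝ)⁻¹ * ∑ a : σ, α ⬝ᵥ (M [a] *ᵥ y) = α ⬝ᵥ y := by
      conv_rhs => rw [← hαA, ← Matrix.dotProduct_mulVec, Matrix.smul_mulVec, dotProduct_smul,
        Matrix.sum_mulVec, dotProduct_sum, smul_eq_mul]
    rw [Finset.sum_const, Finset.card_univ, nsmul_eq_mul, ← h, mul_inv_cancel_left₀ hcard]
  exact (Finset.sum_eq_sum_iff_of_le fun a _ => hmax _ (hy.mulVec hMm [a])).1 hsum a
    (Finset.mem_univ a)

/-- The weight of a column of maximal weight is preserved by every word. -/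
theorem IsCol.dotProduct_mulVec_eq [DecidableEq Q] [Fintype σ] [Nonempty σ]
    {M : List σ → Matrix Q Q ℝ} (hM0 : M [] = 1) (hMm : ∀ u v, M (u ++ v) = M u * M v) {α : Q → ℝ}
    (hαA : α ᵥ* ((Fintype.card σ : ℝ)⁻¹ • ∑ a : σ, M [a]) = α)
    {y : Q → ℝ} (hy : IsCol M y) (hmax : ∀ z, IsCol M z → α ⬝ᵥ z ≤ α ⬝ᵥ y) (w : List σ) :
    α ⬝ᵥ (M w *ᵥ y) = α ⬝ᵥ y := by
  induction w with
  | nil => rw [hM0, Matrix.one_mulVec]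
  | cons a w ih =>
    rw [← List.singleton_append, hMm, ← Matrix.mulVec_mulVec,
      (hy.mulVec hMm w).dotProduct_letter_mulVec_eq hMm hαA (fun z hz => ih ▸ hmax z hz) a, ih]

/-- By strong connectedness, a nonzero column can be moved to a column containing any state. -/
theorem IsCol.exists_mulVec_apply_eq_one {M : List σ → Matrix Q Q ℝ}
    (hMm : ∀ u v, M (u ++ v) = M u * M v) (hUn : ∀ w i j, M w i j = 0 ∨ M w i j = 1)
    (hSC : ∀ p q : Q, ∃ w, M w p q = 1) {y : Q → ℝ} (hy : IsCol M y) (hy0 : y ≠ 0) (p : Q) :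
    ∃ w, (M w *ᵥ y) p = 1 := by
  have h01 : ∀ {z}, IsCol M z → ∀ r, z r = 0 ∨ z r = 1 := by
    rintro _ ⟨u, q, rfl⟩ r
    exact hUn u r q
  obtain ⟨r, hr⟩ := Function.ne_iff.1 hy0
  have hr1 : y r = 1 := (h01 hy r).resolve_left hr
  obtain ⟨w, hw⟩ := hSC p r
  refine ⟨w, (h01 (hy.mulVec hMm w) p).resolve_left fun h0 => ?_⟩
  have hnonneg : ∀ s ∈ Finset.univ, 0 ≤ M w p s * y s := fun s _ => by
    rcases hUn w p s with h | h <;> rcases h01 hy s with h' | h' <;> simp [h, h']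
  have hle := Finset.single_le_sum hnonneg (Finset.mem_univ r)
  rw [hw, hr1] at hle
  change ∑ s, M w p s * y s = 0 at h0
  linarith

end Columns

end UFA

theorem pseudo_column_exists {Q σ : Type*} [Fintype Q] [DecidableEq Q] [Nonempty Q]
    [Fintype σ] [Nonempty σ]
    (M : List σ → Matrix Q Q ℝ)
    (hM0 : M [] = 1) (hMm : ∀ u v, M (u ++ v) = M u * M v)
    (hUn : ∀ w i j, M w i j = 0 ∨ M w i j = 1)
    (hComp : ∀ w, M w ≠ 0)
    (hSC : ∀ p q : Q, ∃ w, M w p q = 1)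
    (α β : Q → ℝ) (hα : ∀ q, 0 < α q) (hβ : ∀ q, 0 < β q)
    (hαA : α ᵥ* ((Fintype.card σ : ℝ)⁻¹ • ∑ a : σ, M [a]) = α)
    (hβA : ((Fintype.card σ : ℝ)⁻¹ • ∑ a : σ, M [a]) *ᵥ β = β)
    (hαβ : α ⬝ᵥ β = 1)
 :
    ∀ q : Q, ∃ y : Q → ℝ,
      (∀ w : List σ, α ⬝ᵥ (M w *ᵥ y) = α ⬝ᵥ y) ∧
      y q = 1 ∧ ∀ q' ∉ UFA.Mer M q, y q' = 0 := by
  intro q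
  have hcol : UFA.IsCol M (fun p => M [] p q) := ⟨[], q, rfl⟩
  obtain ⟨y, hy, hmax⟩ :=
    Set.exists_max_image _ (fun y => α ⬝ᵥ y) (UFA.finite_setOf_isCol hUn) ⟨_, hcol⟩
  have hy0 : y ≠ 0 := by
    rintro rfl
    have h := hmax _ hcol
    simp [hM0, dotProduct, Matrix.one_apply] at h
    exact (hα q).not_ge h
  have hinv := UFA.IsCol.dotProduct_mulVec_eq hM0 hMm hαA hy hmax
  obtain ⟨v, hv⟩ := UFA.IsCol.exists_mulVec_apply_eq_one hMm hUn hSC hy hy0 q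
  have hz := UFA.IsCol.mulVec hMm hy v
  refine ⟨M v *ᵥ y, fun w => ?_, hv, fun q' hq' => ?_⟩
  · rw [Matrix.mulVec_mulVec, ← hMm, hinv, hinv]
  · by_contra hne
    have hz_ind := hz.eq_ind hUn
    refine hq' ⟨{p | (M v *ᵥ y) p = 1}, hv, ?_, hz_ind ▸ hz⟩
    obtain ⟨u, r, hur⟩ := hz
    rw [hur] at hne ⊢
    exact (hUn u q' r).resolve_left hne
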